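/- For every I_DEO-constraint system C, the application of the transformation rules Apply and Unif (using the saturated deduction rules L'_DEO, modulo the empty theory) terminates: there is no infinite sequence of transformation steps starting from C. -/

import Mathlib

set_option maxHeartbeats 1000000

namespace Paper

/-- First-order terms over a signature `Sg` with arities `ar`, with free
constants (indexed by `ℕ`) and variables (indexed by `ℕ`). -/
inductive Tm (Sg : Type) (ar : Sg → ℕ) : Type where
  | var : ℕ → Tm Sg ar
  | cst : ℕ → Tm Sg ar
  | app : (s : Sg) → (Fin (ar s) → Tm Sg ar) → Tm Sg ar

variable {Sg : Type} {ar : Sg → ℕ}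

/-- Substitutions. -/
abbrev Subst (Sg : Type) (ar : Sg → ℕ) := ℕ → Tm Sg ar

/-- Application of a substitution to a term. -/
def subst (σ : Subst Sg ar) : Tm Sg ar → Tm Sg ar
  | .var n => σ n
  | .cst c => .cst c
  | .app s a => .app s (fun i => subst σ (a i))

/-- Composition of substitutions: `scomp τ σ` first applies `σ`, then `τ`. -/
def scomp (τ σ : Subst Sg ar) : Subst Sg ar := fun n => subst τ (σ n)

def isVar : Tm Sg ar → Prop
  | .var _ => True
  | _ => False

def isVarB : Tm Sg ar → Bool
  | .var _ => true
  | _ => false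

/-- The set of variables of a term. -/
def vars : Tm Sg ar → Set ℕ
  | .var n => {n}
  | .cst _ => ∅
  | .app _ a => ⋃ i, vars (a i)

/-- A term is ground if it has no variables. -/
def Ground (t : Tm Sg ar) : Prop := vars t = ∅

/-- The subterm of `t` at position `p` (a sequence of argument indices). -/
def subtermAt : Tm Sg ar → List ℕ → Option (Tm Sg ar)
  | t, [] => some t
  | .var _, _ :: _ => none
  | .cst _, _ :: _ => none
  | .app s a, i :: p => if h : i < ar s then subtermAt (a ⟨i, h⟩) p else none

/-- Replacement of the subterm at position `p` by `u`. -/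
def replaceAt : Tm Sg ar → List ℕ → Tm Sg ar → Tm Sg ar
  | _, [], u => u
  | .var n, _ :: _, _ => .var n
  | .cst c, _ :: _, _ => .cst c
  | .app s a, i :: p, u => .app s (fun j => if j.1 = i then replaceAt (a j) p u else a j)

/-- The set of subterms of a term. -/
def subterms (t : Tm Sg ar) : Set (Tm Sg ar) := {u | ∃ p, subtermAt t p = some u}

/-- The number of symbols of a term. -/
def tmSize : Tm Sg ar → ℕ
  | .var _ => 1
  | .cst _ => 1
  | .app _ a => 1 + Finset.univ.sum (fun i => tmSize (a i))

/-- One-step rewriting with the rules `R` (closed under substitution and contexts). -/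
inductive Rew (R : Tm Sg ar → Tm Sg ar → Prop) : Tm Sg ar → Tm Sg ar → Prop where
  | root : ∀ (l r : Tm Sg ar) (σ : Subst Sg ar), R l r → Rew R (subst σ l) (subst σ r)
  | congr : ∀ (s : Sg) (a b : Fin (ar s) → Tm Sg ar) (i : Fin (ar s)),
      Rew R (a i) (b i) → (∀ j, j ≠ i → a j = b j) → Rew R (Tm.app s a) (Tm.app s b)

/-- The reflexive-transitive closure of rewriting. -/
def Reduces (R : Tm Sg ar → Tm Sg ar → Prop) : Tm Sg ar → Tm Sg ar → Prop :=
  Relation.ReflTransGen (Rew R)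

/-- A term is in normal form if no rewriting step applies to it. -/
def NormalForm (R : Tm Sg ar → Tm Sg ar → Prop) (t : Tm Sg ar) : Prop := ∀ u, ¬ Rew R t u

/-- A substitution is in normal form if all its images are. -/
def NormalSubst (R : Tm Sg ar → Tm Sg ar → Prop) (σ : Subst Sg ar) : Prop :=
  ∀ n, NormalForm R (σ n)

/-- Termination of rewriting: no infinite rewriting sequences. -/
def Terminating (R : Tm Sg ar → Tm Sg ar → Prop) : Prop :=
  WellFounded (fun a b : Tm Sg ar => Rew R b a)

/-- Confluence of rewriting. -/
def Confluent (R : Tm Sg ar → Tm Sg ar → Prop) : Prop :=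
  ∀ a b c : Tm Sg ar, Reduces R a b → Reduces R a c →
    ∃ d, Reduces R b d ∧ Reduces R c d

/-- Convergence: termination together with confluence. -/
def Convergent (R : Tm Sg ar → Tm Sg ar → Prop) : Prop := Terminating R ∧ Confluent R

/-- The equational theory generated by a set of axioms `A`: the smallest
congruence containing all substitution instances of the axioms. -/
inductive EqTh (A : Tm Sg ar → Tm Sg ar → Prop) : Tm Sg ar → Tm Sg ar → Prop where
  | ax : ∀ (l r : Tm Sg ar) (σ : Subst Sg ar), A l r → EqTh A (subst σ l) (subst σ r)
  | refl : ∀ t, EqTh A t t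
  | symm : ∀ {t u}, EqTh A t u → EqTh A u t
  | trans : ∀ {t u v}, EqTh A t u → EqTh A u v → EqTh A t v
  | congr : ∀ (s : Sg) (a b : Fin (ar s) → Tm Sg ar),
      (∀ i, EqTh A (a i) (b i)) → EqTh A (Tm.app s a) (Tm.app s b)

/-- `σ` unifies `u` and `v` syntactically. -/
def Unifies (σ : Subst Sg ar) (u v : Tm Sg ar) : Prop := subst σ u = subst σ v

/-- `σ` is a most general (syntactic) unifier of `u` and `v`. -/
def IsMGU (σ : Subst Sg ar) (u v : Tm Sg ar) : Prop :=
  Unifies σ u v ∧ ∀ τ, Unifies τ u v → ∃ ρ, ∀ n, τ n = subst ρ (σ n)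

def UnifiesSys (σ : Subst Sg ar) (S : List (Tm Sg ar × Tm Sg ar)) : Prop :=
  ∀ e ∈ S, subst σ e.1 = subst σ e.2

/-- `σ` is a most general (syntactic) unifier of the system `S`. -/
def IsMGUSys (σ : Subst Sg ar) (S : List (Tm Sg ar × Tm Sg ar)) : Prop :=
  UnifiesSys σ S ∧ ∀ τ, UnifiesSys τ S → ∃ ρ, ∀ n, τ n = subst ρ (σ n)

/-- `σ` is an `H`-unifier (modulo the theory generated by `A`) of the system `S`. -/
def HUnifier (A : Tm Sg ar → Tm Sg ar → Prop) (σ : Subst Sg ar)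
    (S : List (Tm Sg ar × Tm Sg ar)) : Prop :=
  ∀ e ∈ S, EqTh A (subst σ e.1) (subst σ e.2)

/-- Narrowing: `t ⤳ t'` with substitution `σ`, using a rule `l → r` of `R` at a
non-variable position `p` of `t`, where `σ = mgu(t|_p, l)`. -/
def Narrow (R : Tm Sg ar → Tm Sg ar → Prop) (t : Tm Sg ar) (σ : Subst Sg ar)
    (t' : Tm Sg ar) : Prop :=
  ∃ l r p u, R l r ∧ subtermAt t p = some u ∧ ¬ isVar u ∧ IsMGU σ u l ∧
    t' = replaceAt (subst σ t) p (subst σ r)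

/-- The non-variable positions of a term. -/
def nonVarPos (t : Tm Sg ar) : Set (List ℕ) :=
  {p | ∃ u, subtermAt t p = some u ∧ ¬ isVar u}

/-- A configuration for basic narrowing: a term with its set of basic positions. -/
abbrev Conf (Sg : Type) (ar : Sg → ℕ) := Tm Sg ar × Set (List ℕ)

/-- One basic narrowing step: narrowing at a basic position; the basic positions
of the result are those of the source not below the redex position `p`,
together with `p·q` for `q` a non-variable position of the right-hand side. -/
def BNStep (R : Tm Sg ar → Tm Sg ar → Prop) (c : Conf Sg ar) (σ : Subst Sg ar)
    (c' : Conf Sg ar) : Prop :=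
  ∃ l r p u, R l r ∧ p ∈ c.2 ∧ subtermAt c.1 p = some u ∧ ¬ isVar u ∧ IsMGU σ u l ∧
    c'.1 = replaceAt (subst σ c.1) p (subst σ r) ∧
    c'.2 = {q | q ∈ c.2 ∧ ¬ (p <+: q)} ∪ {q | ∃ q', q = p ++ q' ∧ q' ∈ nonVarPos r}

/-- Sequences of basic narrowing steps, recording the composed substitution. -/
inductive BN (R : Tm Sg ar → Tm Sg ar → Prop) : Conf Sg ar → Subst Sg ar → Conf Sg ar → Prop where
  | refl : ∀ c, BN R c Tm.var c
  | step : ∀ {c c' c'' : Conf Sg ar} {σ θ : Subst Sg ar},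
      BNStep R c σ c' → BN R c' θ c'' → BN R c (scomp θ σ) c''

/-- Basic narrowing between terms, starting with all non-variable positions basic. -/
def BNTerms (R : Tm Sg ar → Tm Sg ar → Prop) (t : Tm Sg ar) (σ : Subst Sg ar)
    (t' : Tm Sg ar) : Prop :=
  ∃ B, BN R (t, nonVarPos t) σ (t', B)

/-! ### Intruder deduction systems -/

/-- An intruder deduction rule `l ↠ r`: a set of premises and a conclusion. -/
abbrev Rule (Sg : Type) (ar : Sg → ℕ) := Set (Tm Sg ar) × Tm Sg ar

/-- One deduction step modulo the equational theory generated by `A`. -/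
def DedStep (L : Set (Rule Sg ar)) (A : Tm Sg ar → Tm Sg ar → Prop)
    (E F : Set (Tm Sg ar)) : Prop :=
  ∃ l r σ r', (l, r) ∈ L ∧ (∀ u ∈ l, ∃ u' ∈ E, EqTh A (subst σ u) u') ∧
    EqTh A (subst σ r) r' ∧ F = E ∪ {r'}

/-- `t` is derivable from `E` modulo `A`. -/
def Deriv (L : Set (Rule Sg ar)) (A : Tm Sg ar → Tm Sg ar → Prop)
    (E : Set (Tm Sg ar)) (t : Tm Sg ar) : Prop :=
  ∃ F, Relation.ReflTransGen (DedStep L A) E F ∧ t ∈ F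

/-- One deduction step modulo the empty equational theory. -/
def DedStepSyn (L : Set (Rule Sg ar)) (E F : Set (Tm Sg ar)) : Prop :=
  ∃ l r σ, (l, r) ∈ L ∧ (∀ u ∈ l, subst σ u ∈ E) ∧ F = E ∪ {subst σ r}

/-- `t` is derivable from `E` modulo the empty theory. -/
def DerivSyn (L : Set (Rule Sg ar)) (E : Set (Tm Sg ar)) (t : Tm Sg ar) : Prop :=
  ∃ F, Relation.ReflTransGen (DedStepSyn L) E F ∧ t ∈ F

/-! ### Constraint systems -/

/-- A constraint system with variable right-hand sides: a sequence of pairs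
`(E_i, v_i)` of a finite knowledge set and a variable. -/
abbrev CSys (Sg : Type) (ar : Sg → ℕ) := List (List (Tm Sg ar) × ℕ)

/-- A general (extended) constraint system: deduction constraints `E_i ▷ t_i`. -/
abbrev GCS (Sg : Type) (ar : Sg → ℕ) := List (List (Tm Sg ar) × Tm Sg ar)

/-- The set of instances by `σ` of the members of `E`. -/
def substList (σ : Subst Sg ar) (E : List (Tm Sg ar)) : Set (Tm Sg ar) :=
  {u | ∃ e ∈ E, u = subst σ e}

/-- Well-formedness of a constraint system `((E_i ▷ v_i))_i`: knowledge
monotonicity and origination of variables. -/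
def WFC (C : CSys Sg ar) : Prop :=
  (∀ i j (hi : i < C.length) (hj : j < C.length), i ≤ j →
     ∀ u ∈ (C.get ⟨i, hi⟩).1, u ∈ (C.get ⟨j, hj⟩).1) ∧
  (∀ i (hi : i < C.length), ∀ u ∈ (C.get ⟨i, hi⟩).1, ∀ x ∈ vars u,
     ∃ j, ∃ hj : j < C.length, j < i ∧ (C.get ⟨j, hj⟩).2 = x)

/-- Well-formedness of a general constraint system `((E_i ▷ t_i))_i`. -/
def WFG (C : GCS Sg ar) : Prop :=
  (∀ i j (hi : i < C.length) (hj : j < C.length), i ≤ j →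
     ∀ u ∈ (C.get ⟨i, hi⟩).1, u ∈ (C.get ⟨j, hj⟩).1) ∧
  (∀ i (hi : i < C.length), ∀ u ∈ (C.get ⟨i, hi⟩).1, ∀ x ∈ vars u,
     ∃ j, ∃ hj : j < C.length, j < i ∧ (C.get ⟨j, hj⟩).2 = Tm.var x)

/-- `σ` satisfies the constraint system `(C, S)` in the intruder system given by
deduction rules `L` modulo the theory generated by `A`. -/
def SatC (L : Set (Rule Sg ar)) (A : Tm Sg ar → Tm Sg ar → Prop)
    (σ : Subst Sg ar) (C : CSys Sg ar) (S : List (Tm Sg ar × Tm Sg ar)) : Prop :=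
  (∀ p ∈ C, Deriv L A (substList σ p.1) (σ p.2)) ∧ HUnifier A σ S

/-- `σ` satisfies the deduction constraints of `C` modulo `A`. -/
def SatG (L : Set (Rule Sg ar)) (A : Tm Sg ar → Tm Sg ar → Prop)
    (σ : Subst Sg ar) (C : GCS Sg ar) : Prop :=
  ∀ p ∈ C, Deriv L A (substList σ p.1) (subst σ p.2)

/-- `σ` satisfies the deduction constraints of `C` modulo the empty theory. -/
def SatGSyn (L : Set (Rule Sg ar)) (σ : Subst Sg ar) (C : GCS Sg ar) : Prop :=
  ∀ p ∈ C, DerivSyn L (substList σ p.1) (subst σ p.2)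

/-- A general constraint system is in solved form when every right-hand side is
a variable. -/
def SolvedForm (C : GCS Sg ar) : Prop := ∀ p ∈ C, isVar p.2

/-- Viewing a constraint system with variable right-hand sides as a general one. -/
def toGCS (C : CSys Sg ar) : GCS Sg ar := C.map (fun p => (p.1, Tm.var p.2))

/-- Componentwise basic narrowing of lists of terms. -/
def ListNarrow (R : Tm Sg ar → Tm Sg ar → Prop) (E E' : List (Tm Sg ar)) : Prop :=
  E.length = E'.length ∧
  ∀ i (h : i < E.length) (h' : i < E'.length),
    ∃ μ, BNTerms R (E.get ⟨i, h⟩) μ (E'.get ⟨i, h'⟩)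

/-- `C'` is obtained from `C` by applying basic narrowing steps to the
subterms of `C`. -/
def CNarrow (R : Tm Sg ar → Tm Sg ar → Prop) (C C' : GCS Sg ar) : Prop :=
  C.length = C'.length ∧
  ∀ i (h : i < C.length) (h' : i < C'.length),
    ListNarrow R (C.get ⟨i, h⟩).1 (C'.get ⟨i, h'⟩).1 ∧
    ∃ μ, BNTerms R (C.get ⟨i, h⟩).2 μ (C'.get ⟨i, h'⟩).2

/-! ### Saturation -/

/-- Rule `ρ` is subsumed by a rule of `L`. -/
def Subsumed (L : Set (Rule Sg ar)) (ρ : Rule Sg ar) : Prop :=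
  ∃ l1, (l1, ρ.2) ∈ L ∧ l1 ⊆ ρ.1

/-- One narrowing step on a deduction rule `(l, r)`, performed on the
conclusion or on one of the premises, instantiating the rest. -/
def RuleNarrow (R : Tm Sg ar → Tm Sg ar → Prop) (ρ ρ' : Rule Sg ar) : Prop :=
  (∃ σ r', Narrow R ρ.2 σ r' ∧ ρ' = ((subst σ) '' ρ.1, r')) ∨
  (∃ u ∈ ρ.1, ∃ σ u', Narrow R u σ u' ∧
      ρ' = (insert u' ((subst σ) '' (ρ.1 \ {u})), subst σ ρ.2))

/-- The saturation rules of Figure 1: Subsumption, Closure and Narrow. -/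
inductive SatStep (R : Tm Sg ar → Tm Sg ar → Prop) :
    Set (Rule Sg ar) → Set (Rule Sg ar) → Prop where
  | subsum : ∀ {L : Set (Rule Sg ar)} {l1 l2 : Set (Tm Sg ar)} {r : Tm Sg ar},
      (l1, r) ∈ L → (l2, r) ∈ L → l1 ⊆ l2 → l1 ≠ l2 → SatStep R L (L \ {(l2, r)})
  | closure : ∀ {L : Set (Rule Sg ar)} {l1 l2 : Set (Tm Sg ar)}
      {r1 t r2 : Tm Sg ar} {σ : Subst Sg ar},
      (l1, r1) ∈ L → (insert t l2, r2) ∈ L → ¬ isVar t → IsMGU σ r1 t →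
      SatStep R L (insert ((subst σ) '' (l1 ∪ l2), subst σ r2) L)
  | narrow : ∀ {L : Set (Rule Sg ar)} {ρ ρ' : Rule Sg ar},
      ρ ∈ L → RuleNarrow R ρ ρ' → SatStep R L (insert ρ' L)

/-- `L` is saturated: every rule produced by Closure or Narrow is subsumed. -/
def Saturated (R : Tm Sg ar → Tm Sg ar → Prop) (L : Set (Rule Sg ar)) : Prop :=
  (∀ (l1 l2 : Set (Tm Sg ar)) (r1 t r2 : Tm Sg ar) (σ : Subst Sg ar),
     (l1, r1) ∈ L → (insert t l2, r2) ∈ L → ¬ isVar t → IsMGU σ r1 t →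
     Subsumed L ((subst σ) '' (l1 ∪ l2), subst σ r2)) ∧
  (∀ ρ ∈ L, ∀ ρ', RuleNarrow R ρ ρ' → Subsumed L ρ')

/-! ### Transformation rules on constraint systems (Figure 2) -/

/-- Instantiation of a constraint system. -/
def csubst (σ : Subst Sg ar) (C : GCS Sg ar) : GCS Sg ar :=
  C.map (fun p => (p.1.map (subst σ), subst σ p.2))

/-- The transformation rules `Unif` and `Apply` of Figure 2, applied to the
first deduction constraint whose right-hand side is not a variable. -/
inductive TStep (L' : Set (Rule Sg ar)) : GCS Sg ar → GCS Sg ar → Prop where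
  | unif : ∀ {Cα Cβ : GCS Sg ar} {E : List (Tm Sg ar)} {t u : Tm Sg ar} {σ : Subst Sg ar},
      SolvedForm Cα → ¬ isVar t → u ∈ E → ¬ isVar u → IsMGU σ u t →
      TStep L' (Cα ++ (E, t) :: Cβ) (csubst σ (Cα ++ Cβ))
  | apply : ∀ {Cα Cβ : GCS Sg ar} {E : List (Tm Sg ar)} {t r : Tm Sg ar}
      {l : Set (Tm Sg ar)} {lx lnl el : List (Tm Sg ar)} {σ : Subst Sg ar},
      SolvedForm Cα → ¬ isVar t → (l, r) ∈ L' →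
      (∀ u ∈ lx, isVar u) → (∀ u, u ∈ l ↔ (u ∈ lx ∨ u ∈ lnl)) →
      el.length = lnl.length → (∀ e ∈ el, e ∈ E) →
      IsMGUSys σ ((el.zip lnl) ++ [(r, t)]) →
      TStep L' (Cα ++ (E, t) :: Cβ)
        (csubst σ (Cα ++ (lx.map (fun y => (E, y))) ++ Cβ))

/-! ### Narrowing of unification systems (for Hullot's procedure) -/

/-- An equation between two basic-narrowing configurations. -/
abbrev EqConf (Sg : Type) (ar : Sg → ℕ) := Conf Sg ar × Conf Sg ar

def csub (σ : Subst Sg ar) (e : EqConf Sg ar) : EqConf Sg ar :=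
  ((subst σ e.1.1, e.1.2), (subst σ e.2.1, e.2.2))

/-- One basic narrowing step on one side of one equation of the system, the
substitution being applied to the whole system. -/
def SysBNStep (R : Tm Sg ar → Tm Sg ar → Prop) (c : List (EqConf Sg ar))
    (σ : Subst Sg ar) (c' : List (EqConf Sg ar)) : Prop :=
  ∃ (i : Fin c.length) (side : Bool) (d : Conf Sg ar),
    BNStep R (if side then (c.get i).1 else (c.get i).2) σ d ∧
    c' = (c.map (csub σ)).set i.1
      (if side then (d, (csub σ (c.get i)).2) else ((csub σ (c.get i)).1, d))

/-- Sequences of basic narrowing steps on a unification system, recording the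
composed substitution. -/
inductive SysBN (R : Tm Sg ar → Tm Sg ar → Prop) :
    List (EqConf Sg ar) → Subst Sg ar → List (EqConf Sg ar) → Prop where
  | refl : ∀ c, SysBN R c Tm.var c
  | step : ∀ {c c' c'' : List (EqConf Sg ar)} {σ θ : Subst Sg ar},
      SysBNStep R c σ c' → SysBN R c' θ c'' → SysBN R c (scomp θ σ) c''

/-- The initial configuration of a unification system: all non-variable
positions are basic. -/
def initConf (S : List (Tm Sg ar × Tm Sg ar)) : List (EqConf Sg ar) :=
  S.map (fun e => ((e.1, nonVarPos e.1), (e.2, nonVarPos e.2)))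

/-- The substitutions output by Hullot's procedure on the system `S`: a basic
narrowing derivation followed by syntactic unification of the resulting system. -/
def ProcOutput (R : Tm Sg ar → Tm Sg ar → Prop) (S : List (Tm Sg ar × Tm Sg ar))
    (δ : Subst Sg ar) : Prop :=
  ∃ c' σ τ, SysBN R (initConf S) σ c' ∧
    IsMGUSys τ (c'.map (fun e => (e.1.1, e.2.1))) ∧ δ = scomp τ σ

/-- The size of a unification system. -/
def sysSize (S : List (Tm Sg ar × Tm Sg ar)) : ℕ :=
  (S.map (fun e => tmSize e.1 + tmSize e.2)).sum

/-- The size of a certificate (a substitution presented as a finite list). -/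
def certSize (c : List (ℕ × Tm Sg ar)) : ℕ := (c.map (fun e => tmSize e.2)).sum

/-! ### The DSKS signature -/

/-- The signature G_DSKS = {Sig, Ver, SK', PK', 0, 1, SK, PK}. -/
inductive SgD : Type | sig | ver | skp | pkp | zero | one | sk | pk

def arD : SgD → ℕ
  | .sig => 2 | .ver => 3 | .skp => 2 | .pkp => 2
  | .zero => 0 | .one => 0 | .sk => 1 | .pk => 1

abbrev TmD := Tm SgD arD

def dSig (a b : TmD) : TmD := .app .sig ![a, b]
def dVer (a b c : TmD) : TmD := .app .ver ![a, b, c]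
def dSkp (a b : TmD) : TmD := .app .skp ![a, b]
def dPkp (a b : TmD) : TmD := .app .pkp ![a, b]
def dSk (a : TmD) : TmD := .app .sk ![a]
def dPk (a : TmD) : TmD := .app .pk ![a]
def dZero : TmD := .app .zero ![]
def dOne : TmD := .app .one ![]

def xD : TmD := .var 0
def yD : TmD := .var 1
def zD : TmD := .var 2
def y1D : TmD := .var 1
def y2D : TmD := .var 2

/-- The convergent rewrite system R_DSKS. -/
inductive RDSKS : TmD → TmD → Prop where
  | r1 : RDSKS (dVer xD (dSig xD (dSk yD)) (dPk yD)) dOne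
  | r2 : RDSKS (dVer xD (dSig xD (dSkp y1D y2D)) (dPkp y1D y2D)) dOne
  | r3 : RDSKS (dVer xD (dSig xD (dSk yD)) (dPkp (dPk yD) (dSig xD (dSk yD)))) dOne
  | r4 : RDSKS (dSig xD (dSkp (dPk yD) (dSig xD (dSk yD)))) (dSig xD (dSk yD))

/-- The axioms A_DSKS presenting the equational theory H_DSKS. -/
inductive ADSKS : TmD → TmD → Prop where
  | a1 : ADSKS (dVer xD (dSig xD (dSk yD)) (dPk yD)) dOne
  | a2 : ADSKS (dVer xD (dSig xD (dSkp y1D y2D)) (dPkp y1D y2D)) dOne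
  | a3 : ADSKS (dSig xD (dSkp (dPk yD) (dSig xD (dSk yD)))) (dSig xD (dSk yD))

/-- The intruder deduction rules L_DSKS. -/
def LDSKS : Set (Rule SgD arD) :=
  { (({xD, yD} : Set TmD), dSig xD yD), (({xD, yD, zD} : Set TmD), dVer xD yD zD),
    (({xD, yD} : Set TmD), dSkp xD yD), (({xD, yD} : Set TmD), dPkp xD yD),
    ((∅ : Set TmD), dZero), ((∅ : Set TmD), dOne) }

/-- The saturated deduction rules L'_DSKS. -/
def LDSKS' : Set (Rule SgD arD) :=
  LDSKS ∪ { (({xD, dSk yD} : Set TmD), dSig xD (dSk yD)),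
            (({xD, dSkp (dPk yD) (dSig xD (dSk yD))} : Set TmD), dSig xD (dSk yD)) }

/-! ### The DEO signature -/

/-- The signature G_DEO = {Sig, Ver, SK'', PK'', f, 0, 1, SK, PK}. -/
inductive SgE : Type | sig | ver | skp | pkp | f | zero | one | sk | pk

def arE : SgE → ℕ
  | .sig => 2 | .ver => 3 | .skp => 2 | .pkp => 2 | .f => 2
  | .zero => 0 | .one => 0 | .sk => 1 | .pk => 1

abbrev TmE := Tm SgE arE

def eSig (a b : TmE) : TmE := .app .sig ![a, b]
def eVer (a b c : TmE) : TmE := .app .ver ![a, b, c]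
def eSkp (a b : TmE) : TmE := .app .skp ![a, b]
def ePkp (a b : TmE) : TmE := .app .pkp ![a, b]
def eF (a b : TmE) : TmE := .app .f ![a, b]
def eSk (a : TmE) : TmE := .app .sk ![a]
def ePk (a : TmE) : TmE := .app .pk ![a]
def eZero : TmE := .app .zero ![]
def eOne : TmE := .app .one ![]

def xE : TmE := .var 0
def yE : TmE := .var 1
def zE : TmE := .var 2
def y1E : TmE := .var 1
def y2E : TmE := .var 2

/-- The convergent rewrite system R_DEO. -/
inductive RDEO : TmE → TmE → Prop where
  | r1 : RDEO (eVer xE (eSig xE (eSk yE)) (ePk yE)) eOne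
  | r2 : RDEO (eVer xE (eSig xE (eSkp y1E y2E)) (ePkp y1E y2E)) eOne
  | r3 : RDEO (eVer (eF (ePk yE) (eSig xE (eSk yE))) (eSig xE (eSk yE))
      (ePkp (ePk yE) (eSig xE (eSk yE)))) eOne
  | r4 : RDEO (eSig (eF (ePk yE) (eSig xE (eSk yE))) (eSkp (ePk yE) (eSig xE (eSk yE))))
      (eSig xE (eSk yE))

/-- The axioms A_DEO presenting the equational theory H_DEO. -/
inductive ADEO : TmE → TmE → Prop where
  | a1 : ADEO (eVer xE (eSig xE (eSk yE)) (ePk yE)) eOne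
  | a2 : ADEO (eVer xE (eSig xE (eSkp y1E y2E)) (ePkp y1E y2E)) eOne
  | a3 : ADEO (eSig (eF (ePk yE) (eSig xE (eSk yE))) (eSkp (ePk yE) (eSig xE (eSk yE))))
      (eSig xE (eSk yE))

/-- The intruder deduction rules L_DEO. -/
def LDEO : Set (Rule SgE arE) :=
  { (({xE, yE} : Set TmE), eSig xE yE), (({xE, yE, zE} : Set TmE), eVer xE yE zE),
    (({xE, yE} : Set TmE), eSkp xE yE), (({xE, yE} : Set TmE), ePkp xE yE),
    (({xE, yE} : Set TmE), eF xE yE),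
    ((∅ : Set TmE), eZero), ((∅ : Set TmE), eOne) }

/-- The saturated deduction rules L'_DEO. -/
def LDEO' : Set (Rule SgE arE) :=
  LDEO ∪ { (({eF (ePk yE) (eSig xE (eSk yE)), eSkp (ePk yE) (eSig xE (eSk yE))} : Set TmE),
            eSig xE (eSk yE)) }


end Paper

namespace Paper

section Unification

variable {Sg : Type} {ar : Sg → ℕ}

theorem vars_finite (t : Tm Sg ar) : (vars t).Finite := by
  induction t with
  | var n => simp [vars]
  | cst c => simp [vars]
  | app s a ih => simpa [vars] using Set.finite_iUnion ih

/-- The finite set of variables of a term. -/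
noncomputable def varsFinset (t : Tm Sg ar) : Finset ℕ := (vars_finite t).toFinset

theorem mem_varsFinset {t : Tm Sg ar} {n : ℕ} : n ∈ varsFinset t ↔ n ∈ vars t := by
  simp [varsFinset]

/-- The variables occurring in the images under `σ` of the variables in `V`. -/
noncomputable def imageVars (σ : Subst Sg ar) (V : Finset ℕ) : Finset ℕ :=
  V.biUnion fun n => varsFinset (σ n)

theorem mem_imageVars {σ : Subst Sg ar} {V : Finset ℕ} {m : ℕ} :
    m ∈ imageVars σ V ↔ ∃ n ∈ V, m ∈ vars (σ n) := by
  simp [imageVars, mem_varsFinset]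

theorem mem_vars_subst {σ : Subst Sg ar} {t : Tm Sg ar} {m : ℕ} :
    m ∈ vars (subst σ t) ↔ ∃ n ∈ vars t, m ∈ vars (σ n) := by
  induction t with
  | var n => simp [vars, subst]
  | cst c => simp [vars, subst]
  | app s a ih =>
    simp only [vars, subst, Set.mem_iUnion, ih]
    exact ⟨fun ⟨i, n, hn, hm⟩ => ⟨n, ⟨i, hn⟩, hm⟩, fun ⟨n, ⟨i, hn⟩, hm⟩ => ⟨i, n, hn, hm⟩⟩

theorem subst_congr {σ τ : Subst Sg ar} {t : Tm Sg ar} (h : ∀ n ∈ vars t, σ n = τ n) :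
    subst σ t = subst τ t := by
  induction t with
  | var n => exact h n (by simp [vars])
  | cst c => rfl
  | app s a ih =>
    simp only [subst, Tm.app.injEq, heq_eq_eq, true_and]
    funext i
    exact ih i fun n hn => h n (by simpa [vars] using ⟨i, hn⟩)

theorem subst_scomp (τ σ : Subst Sg ar) (t : Tm Sg ar) :
    subst (scomp τ σ) t = subst τ (subst σ t) := by
  induction t with
  | var n => rfl
  | cst c => rfl
  | app s a ih => simp [subst, ih]

theorem subst_subst_eq {σ π : Subst Sg ar} (h : ∀ n, subst σ (π n) = σ n) (t : Tm Sg ar) :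
    subst σ (subst π t) = subst σ t := by
  rw [← subst_scomp]
  exact subst_congr fun n _ => h n

theorem tmSize_lt_of_mem_vars (θ : Subst Sg ar) {x : ℕ} {s : Sg} {a : Fin (ar s) → Tm Sg ar}
    {i : Fin (ar s)} (h : tmSize (θ x) ≤ tmSize (subst θ (a i))) :
    tmSize (θ x) < tmSize (subst θ (.app s a)) := by
  have := Finset.single_le_sum (f := fun i => tmSize (subst θ (a i)))
    (fun _ _ => Nat.zero_le _) (Finset.mem_univ i)
  simp only [subst, tmSize]
  omega

theorem tmSize_le_of_mem_vars (θ : Subst Sg ar) {x : ℕ} {t : Tm Sg ar} (h : x ∈ vars t) :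
    tmSize (θ x) ≤ tmSize (subst θ t) := by
  induction t with
  | var n => simp_all [vars, subst]
  | cst c => simp [vars] at h
  | app s a ih =>
    obtain ⟨i, hi⟩ := by simpa [vars] using h
    exact (tmSize_lt_of_mem_vars θ (ih i hi)).le

/-- The occurs check. -/
theorem notMem_vars_of_unifies {θ : Subst Sg ar} {x : ℕ} {t : Tm Sg ar}
    (h : θ x = subst θ t) (hne : t ≠ .var x) : x ∉ vars t := by
  intro hx
  cases t with
  | var n => simp_all [vars]
  | cst c => simp [vars] at hx
  | app s a =>
    obtain ⟨i, hi⟩ := by simpa [vars] using hx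
    have := tmSize_lt_of_mem_vars θ (tmSize_le_of_mem_vars θ hi)
    rw [h] at this
    exact lt_irrefl _ this

/-- Distinct unifiable terms disagree at a variable `x` of one and a subterm `s` of the other. -/
theorem exists_binding_of_unifies {θ : Subst Sg ar} {u v : Tm Sg ar}
    (h : subst θ u = subst θ v) (hne : u ≠ v) :
    ∃ x s, x ∈ vars u ∪ vars v ∧ vars s ⊆ vars u ∪ vars v ∧ x ∉ vars s ∧
      ∀ τ : Subst Sg ar, subst τ u = subst τ v → τ x = subst τ s := by
  induction u generalizing v with
  | var x =>
    exact ⟨x, v, by simp [vars], by simp, notMem_vars_of_unifies h hne.symm, fun _ hτ => hτ⟩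
  | cst c =>
    cases v with
    | var x => exact ⟨x, .cst c, by simp [vars], by simp, by simp [vars], fun _ hτ => hτ.symm⟩
    | cst d => simp_all [subst]
    | app s a => simp [subst] at h
  | app s a ih =>
    cases v with
    | var x =>
      exact ⟨x, .app s a, by simp [vars], by simp, notMem_vars_of_unifies h.symm hne,
        fun _ hτ => hτ.symm⟩
    | cst d => simp [subst] at h
    | app s' b =>
      simp only [subst, Tm.app.injEq] at h
      obtain ⟨rfl, h⟩ := h
      have h := eq_of_heq h
      obtain ⟨i, hi⟩ : ∃ i, a i ≠ b i := by
        by_contra! hab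
        exact hne (congrArg _ (funext hab))
      obtain ⟨x, r, hx, hr, hxr, H⟩ := ih i (congrFun h i) hi
      have hsub : vars (a i) ∪ vars (b i) ⊆ vars (Tm.app s a) ∪ vars (Tm.app s b) :=
        Set.union_subset_union (Set.subset_iUnion (fun i => vars (a i)) i)
          (Set.subset_iUnion (fun i => vars (b i)) i)
      refine ⟨x, r, hsub hx, hr.trans hsub, hxr, fun τ hτ => H τ ?_⟩
      simp only [subst, Tm.app.injEq, heq_eq_eq, true_and] at hτ
      exact congrFun hτ i

theorem card_imageVars_le_of_isVar {σ : Subst Sg ar} {V : Finset ℕ}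
    (h : ∀ n ∈ V, isVar (σ n)) : (imageVars σ V).card ≤ V.card := by
  refine (Finset.card_biUnion_le_card_mul V _ 1 fun n hn => ?_).trans (by simp)
  rw [Finset.card_le_one]
  intro a ha b hb
  have := h n hn
  rw [mem_varsFinset] at ha hb
  cases hσ : σ n <;> simp_all [vars, isVar]

/-- A unifier that is most general on `V` either loses a variable or only renames `V`. -/
theorem card_imageVars_lt_or_isVar {σ : Subst Sg ar} {V : Finset ℕ}
    {S : List (Tm Sg ar × Tm Sg ar)} (hσ : UnifiesSys σ S)
    (hV : ∀ e ∈ S, ∀ n ∈ vars e.1 ∪ vars e.2, n ∈ V)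
    (hgen : ∀ τ, UnifiesSys τ S → ∃ ρ, ∀ n ∈ V, τ n = subst ρ (σ n)) :
    (imageVars σ V).card < V.card ∨ ∀ n ∈ V, isVar (σ n) := by
  induction hk : V.card generalizing V S with
  | zero => simp_all
  | succ k ih =>
    by_cases htriv : ∀ e ∈ S, e.1 = e.2
    · right
      obtain ⟨ρ, hρ⟩ := hgen Tm.var fun e he => by rw [htriv e he]
      intro n hn
      have := hρ n hn
      cases hσn : σ n <;> rw [hσn] at this <;> trivial
    · left
      push Not at htriv
      obtain ⟨e, he, hne⟩ := htriv
      obtain ⟨x, s, hx, hs, hxs, H⟩ := exists_binding_of_unifies (hσ e he) hne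
      have hxV : x ∈ V := hV e he x hx
      have hsV : ∀ n ∈ vars s, n ∈ V.erase x := fun n hn =>
        Finset.mem_erase.2 ⟨fun h => hxs (h ▸ hn), hV e he n (hs hn)⟩
      let β : Subst Sg ar := Function.update Tm.var x s
      have hβ : ∀ n, n ≠ x → β n = .var n := fun n hn => Function.update_of_ne hn _ _
      have hβx : β x = s := Function.update_self _ _ _
      have hσβ : ∀ n, subst σ (β n) = σ n := by
        intro n
        by_cases hn : n = x
        · rw [hn, hβx, H σ (hσ e he)]
        · rw [hβ n hn]; rfl
      have hβvars : ∀ n ∈ V, ∀ m ∈ vars (β n), m ∈ V.erase x := by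
        intro n hn m hm
        by_cases hnx : n = x
        · rw [hnx, hβx] at hm
          exact hsV m hm
        · rw [hβ n hnx] at hm
          obtain rfl : m = n := by simpa [vars] using hm
          exact Finset.mem_erase.2 ⟨hnx, hn⟩
      have hcard : (V.erase x).card = k := by rw [Finset.card_erase_of_mem hxV]; omega
      have key := ih (V := V.erase x) (S := S.map fun e => (subst β e.1, subst β e.2))
        (by
          intro e' he'
          obtain ⟨e, he, rfl⟩ := List.mem_map.1 he'
          simpa only [subst_subst_eq hσβ] using hσ e he)
        (by
          intro e' he' m hm
          obtain ⟨e, he, rfl⟩ := List.mem_map.1 he'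
          simp only [Set.mem_union, mem_vars_subst] at hm
          obtain ⟨n, hn, hm⟩ | ⟨n, hn, hm⟩ := hm
          · exact hβvars n (hV e he n (Or.inl hn)) m hm
          · exact hβvars n (hV e he n (Or.inr hn)) m hm)
        (by
          intro τ hτ
          obtain ⟨ρ, hρ⟩ := hgen (scomp τ β) fun e he => by
            simpa only [subst_scomp] using hτ _ (List.mem_map_of_mem he)
          refine ⟨ρ, fun n hn => ?_⟩
          obtain ⟨hnx, hn⟩ := Finset.mem_erase.1 hn
          rw [← hρ n hn, scomp, hβ n hnx]
          rfl)
        hcard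
      have hle : (imageVars σ (V.erase x)).card ≤ k := by
        obtain h | h := key
        · exact h.le
        · exact hcard ▸ card_imageVars_le_of_isVar h
      have hsub : imageVars σ V ⊆ imageVars σ (V.erase x) := by
        intro m hm
        obtain ⟨n, hn, hm⟩ := mem_imageVars.1 hm
        rw [← hσβ n, mem_vars_subst] at hm
        obtain ⟨n', hn', hm⟩ := hm
        exact mem_imageVars.2 ⟨n', hβvars n hn n' hn', hm⟩
      have := Finset.card_le_card hsub
      omega

/-- The dichotomy of `card_imageVars_lt_or_isVar` for a most general unifier, on a set `V`
through which the system factors by a substitution `π` that `σ` absorbs. -/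
theorem IsMGUSys.card_imageVars_lt_or_isVar {σ π : Subst Sg ar} {V : Finset ℕ}
    {S : List (Tm Sg ar × Tm Sg ar)} (hσ : IsMGUSys σ S) (hπ : ∀ n ∈ V, π n = .var n)
    (hσπ : ∀ n, subst σ (π n) = σ n)
    (hV : ∀ e ∈ S, ∀ n ∈ vars e.1 ∪ vars e.2, ∀ m ∈ vars (π n), m ∈ V) :
    (imageVars σ V).card < V.card ∨ ∀ n ∈ V, isVar (σ n) := by
  refine Paper.card_imageVars_lt_or_isVar (S := S.map fun e => (subst π e.1, subst π e.2))
    ?_ ?_ ?_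
  · intro e' he'
    obtain ⟨e, he, rfl⟩ := List.mem_map.1 he'
    simpa only [subst_subst_eq hσπ] using hσ.1 e he
  · intro e' he' m hm
    obtain ⟨e, he, rfl⟩ := List.mem_map.1 he'
    simp only [Set.mem_union, mem_vars_subst] at hm
    obtain ⟨n, hn, hm⟩ | ⟨n, hn, hm⟩ := hm
    · exact hV e he n (Or.inl hn) m hm
    · exact hV e he n (Or.inr hn) m hm
  · intro τ hτ
    obtain ⟨ρ, hρ⟩ := hσ.2 (scomp τ π) fun e he => by
      simpa only [subst_scomp] using hτ _ (List.mem_map_of_mem he)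
    refine ⟨ρ, fun n hn => ?_⟩
    rw [← hρ n, scomp, hπ n hn]
    rfl

/-- `n` occurs in the system `C`. -/
def OccursIn (C : GCS Sg ar) (n : ℕ) : Prop :=
  ∃ p ∈ C, n ∈ vars p.2 ∨ ∃ u ∈ p.1, n ∈ vars u

theorem finite_setOf_occursIn (C : GCS Sg ar) : {n | OccursIn C n}.Finite := by
  have : {n | OccursIn C n} =
      ⋃ p ∈ {p | p ∈ C}, (vars p.2 ∪ ⋃ u ∈ {u | u ∈ p.1}, vars u) := by
    ext n
    simp [OccursIn]
  rw [this]
  exact (List.finite_toSet C).biUnion fun p _ =>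
    (vars_finite _).union ((List.finite_toSet p.1).biUnion fun u _ => vars_finite u)

/-- The finite set of variables of a constraint system. -/
noncomputable def sysVars (C : GCS Sg ar) : Finset ℕ := (finite_setOf_occursIn C).toFinset

theorem mem_sysVars {C : GCS Sg ar} {n : ℕ} : n ∈ sysVars C ↔ OccursIn C n := by
  simp [sysVars]

end Unification

/-- The number of symbols of a term, where terms headed by `SK`, which no composition rule can
decompose, count as atoms. -/
def weight : TmE → ℕ
  | .var _ => 1
  | .cst _ => 1
  | .app .sk _ => 1
  | .app _ a => 1 + ∑ i, weight (a i)

theorem weight_app {s : SgE} (hs : s ≠ .sk) (a : Fin (arE s) → TmE) :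
    weight (.app s a) = 1 + ∑ i, weight (a i) := by
  cases s <;> first | rfl | exact absurd rfl hs

theorem weight_arg_lt {s : SgE} (hs : s ≠ .sk) (a : Fin (arE s) → TmE) (i : Fin (arE s)) :
    weight (a i) < weight (.app s a) := by
  have := Finset.single_le_sum (f := fun i => weight (a i))
    (fun _ _ => Nat.zero_le _) (Finset.mem_univ i)
  rw [weight_app hs]
  omega

theorem weight_eq_one_of_isVar {t : TmE} (h : isVar t) : weight t = 1 := by
  cases t <;> simp_all [isVar, weight]

theorem weight_subst {σ : Subst SgE arE} {t : TmE} (h : ∀ n ∈ vars t, weight (σ n) = 1) :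
    weight (subst σ t) = weight t := by
  induction t with
  | var n => exact h n (by simp [vars])
  | cst c => rfl
  | app s a ih =>
    by_cases hs : s = .sk
    · subst hs
      rfl
    · rw [subst, weight_app hs, weight_app hs]
      congr 1
      refine Finset.sum_congr rfl fun i _ => ih i fun n hn => h n ?_
      simpa [vars] using ⟨i, hn⟩

/-- The multiset of weights of the right-hand sides of a constraint system. -/
def weights (C : GCS SgE arE) : Multiset ℕ := C.map fun p => weight p.2

/-- The termination order: first the number of variables, then the multiset of weights. -/
def Smaller (C' C : GCS SgE arE) : Prop :=
  Prod.Lex (· < ·) (Relation.CutExpand (· < ·))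
    ((sysVars C').card, weights C') ((sysVars C).card, weights C)

theorem wellFounded_smaller : WellFounded Smaller :=
  InvImage.wf (fun C : GCS SgE arE => ((sysVars C).card, weights C))
    (WellFounded.prod_lex wellFounded_lt (WellFounded.cutExpand wellFounded_lt))

theorem weights_csubst {σ : Subst SgE arE} {C : GCS SgE arE}
    (h : ∀ p ∈ C, ∀ n ∈ vars p.2, weight (σ n) = 1) : weights (csubst σ C) = weights C := by
  simp only [weights, csubst, List.map_map]
  congr 1
  exact List.map_congr_left fun p hp => weight_subst (h p hp)

/-- Replacing the constraint `E ▷ t` by constraints `E ▷ y` and instantiating by `σ` makes the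
system smaller when `σ` loses a variable, or keeps weights and every `y` gets lighter than `t`. -/
theorem smaller_csubst {Cα Cβ : GCS SgE arE} {E ts : List TmE} {t : TmE}
    {σ : Subst SgE arE} {V : Finset ℕ} (hV : V = sysVars (Cα ++ (E, t) :: Cβ))
    (hts : ∀ y ∈ ts, ∀ m ∈ vars (subst σ y), m ∈ imageVars σ V)
    (h : (imageVars σ V).card < V.card ∨ (imageVars σ V).card ≤ V.card ∧
      (∀ n ∈ V, weight (σ n) = 1) ∧ ∀ y ∈ ts, weight (subst σ y) < weight t) :
    Smaller (csubst σ (Cα ++ ts.map (fun y => (E, y)) ++ Cβ)) (Cα ++ (E, t) :: Cβ) := by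
  have hsub : sysVars (csubst σ (Cα ++ ts.map (fun y => (E, y)) ++ Cβ)) ⊆ imageVars σ V := by
    have key : ∀ p ∈ Cα ++ (E, t) :: Cβ, ∀ u, u = p.2 ∨ u ∈ p.1 → ∀ m ∈ vars (subst σ u),
        m ∈ imageVars σ V := by
      intro p hp u hu m hm
      obtain ⟨n, hn, hm⟩ := mem_vars_subst.1 hm
      refine mem_imageVars.2 ⟨n, hV ▸ mem_sysVars.2 ⟨p, hp, ?_⟩, hm⟩
      obtain rfl | hu := hu
      · exact Or.inl hn
      · exact Or.inr ⟨u, hu, hn⟩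
    intro m hm
    obtain ⟨q, hq, hm⟩ := mem_sysVars.1 hm
    obtain ⟨p, hp, rfl⟩ := List.mem_map.1 hq
    simp only [List.mem_map, exists_exists_and_eq_and] at hm
    simp only [List.mem_append, List.mem_map] at hp
    obtain (hp | ⟨y, hy, rfl⟩) | hp := hp
    · obtain hm | ⟨u, hu, hm⟩ := hm
      · exact key p (by simp [hp]) _ (Or.inl rfl) m hm
      · exact key p (by simp [hp]) u (Or.inr hu) m hm
    · obtain hm | ⟨u, hu, hm⟩ := hm
      · exact hts y hy m hm
      · exact key (E, t) (by simp) u (Or.inr hu) m hm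
    · obtain hm | ⟨u, hu, hm⟩ := hm
      · exact key p (by simp [hp]) _ (Or.inl rfl) m hm
      · exact key p (by simp [hp]) u (Or.inr hu) m hm
  have hle := Finset.card_le_card hsub
  rw [Smaller, Prod.lex_iff, ← hV]
  obtain hlt | ⟨hle', hw, hlight⟩ := h
  · exact Or.inl (hle.trans_lt hlt)
  obtain hlt | heq := (hle.trans hle').lt_or_eq
  · exact Or.inl hlt
  refine Or.inr ⟨heq, (ts.map fun y => weight (subst σ y) : List ℕ), weight t, ?_, ?_⟩
  · intro a ha
    obtain ⟨y, hy, rfl⟩ := List.mem_map.1 (Multiset.mem_coe.1 ha)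
    exact hlight y hy
  · have hα : weights (csubst σ Cα) = weights Cα := weights_csubst fun p hp n hn =>
      hw n (hV ▸ mem_sysVars.2 ⟨p, by simp [hp], Or.inl hn⟩)
    have hβ : weights (csubst σ Cβ) = weights Cβ := weights_csubst fun p hp n hn =>
      hw n (hV ▸ mem_sysVars.2 ⟨p, by simp [hp], Or.inl hn⟩)
    have hsplit : weights (csubst σ (Cα ++ ts.map (fun y => (E, y)) ++ Cβ)) =
        weights (csubst σ Cα) + (ts.map fun y => weight (subst σ y) : List ℕ) +
          weights (csubst σ Cβ) := by
      simp [weights, csubst, Function.comp_def]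
    have hsplit' : weights (Cα ++ (E, t) :: Cβ) = weights Cα + {weight t} + weights Cβ := by
      simp only [weights, List.map_append, List.map_cons, ← Multiset.coe_add, ← Multiset.cons_coe,
        ← Multiset.singleton_add]
      ac_rfl
    dsimp only
    rw [hsplit, hsplit', hα, hβ]
    ac_rfl

theorem smaller_csubst_of_isVar {Cα Cβ : GCS SgE arE} {E ts : List TmE} {t : TmE}
    {σ : Subst SgE arE}
    (h : (imageVars σ (sysVars (Cα ++ (E, t) :: Cβ))).card <
        (sysVars (Cα ++ (E, t) :: Cβ)).card ∨
      ∀ n ∈ sysVars (Cα ++ (E, t) :: Cβ), isVar (σ n))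
    (hts : ∀ y ∈ ts, ∃ b : TmE, subst σ y = subst σ b ∧ vars b ⊆ vars t ∧ weight b < weight t) :
    Smaller (csubst σ (Cα ++ ts.map (fun y => (E, y)) ++ Cβ)) (Cα ++ (E, t) :: Cβ) := by
  have ht : ∀ n ∈ vars t, n ∈ sysVars (Cα ++ (E, t) :: Cβ) := fun n hn =>
    mem_sysVars.2 ⟨(E, t), by simp, Or.inl hn⟩
  refine smaller_csubst rfl ?_ (h.imp_right fun h => ⟨card_imageVars_le_of_isVar h,
    fun n hn => weight_eq_one_of_isVar (h n hn), ?_⟩)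
  · intro y hy m hm
    obtain ⟨b, hb, hbt, -⟩ := hts y hy
    rw [hb] at hm
    obtain ⟨n, hn, hm⟩ := mem_vars_subst.1 hm
    exact mem_imageVars.2 ⟨n, ht n (hbt hn), hm⟩
  · intro y hy
    obtain ⟨b, hb, hbt, hlt⟩ := hts y hy
    rw [hb, weight_subst fun n hn => weight_eq_one_of_isVar (h n (ht n (hbt hn)))]
    exact hlt

theorem exists_app_of_subst_eq {Sg : Type} {ar : Sg → ℕ} {σ : Subst Sg ar} {s : Sg}
    {a : Fin (ar s) → Tm Sg ar} {t : Tm Sg ar} (ht : ¬ isVar t)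
    (h : subst σ (.app s a) = subst σ t) :
    ∃ b, t = .app s b ∧ ∀ i, subst σ (a i) = subst σ (b i) := by
  cases t with
  | var n => simp [isVar] at ht
  | cst c => simp [subst] at h
  | app s' b =>
    simp only [subst, Tm.app.injEq] at h
    obtain ⟨rfl, h⟩ := h
    exact ⟨b, rfl, congrFun (eq_of_heq h)⟩

theorem mem_vars_of_mem_zip {Sg : Type} {ar : Sg → ℕ} {el lnl : List (Tm Sg ar)} {r t : Tm Sg ar}
    {e : Tm Sg ar × Tm Sg ar} (he : e ∈ el.zip lnl ++ [(r, t)]) {n : ℕ}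
    (hn : n ∈ vars e.1 ∪ vars e.2) :
    (∃ u ∈ t :: el, n ∈ vars u) ∨ ∃ u ∈ r :: lnl, n ∈ vars u := by
  obtain he | rfl : e ∈ el.zip lnl ∨ e = (r, t) := by simpa using he
  · obtain ⟨h₁, h₂⟩ := List.of_mem_zip (a := e.1) (b := e.2) he
    obtain hn | hn := hn
    · exact Or.inl ⟨_, List.mem_cons_of_mem _ h₁, hn⟩
    · exact Or.inr ⟨_, List.mem_cons_of_mem _ h₂, hn⟩
  · obtain hn | hn := hn
    · exact Or.inr ⟨r, by simp, hn⟩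
    · exact Or.inl ⟨t, by simp, hn⟩

theorem mem_sysVars_of_mem_cons {Sg : Type} {ar : Sg → ℕ} {Cα Cβ : GCS Sg ar}
    {E el : List (Tm Sg ar)} {t u : Tm Sg ar} (hel : ∀ e ∈ el, e ∈ E) (hu : u ∈ t :: el) {n : ℕ}
    (hn : n ∈ vars u) : n ∈ sysVars (Cα ++ (E, t) :: Cβ) := by
  refine mem_sysVars.2 ⟨(E, t), by simp, ?_⟩
  obtain rfl | hu := List.mem_cons.1 hu
  · exact Or.inl hn
  · exact Or.inr ⟨u, hel u hu, hn⟩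

open Classical in
/-- The dichotomy of `card_imageVars_lt_or_isVar` on the variables of the system, when `σ`
identifies every further rule variable `n` with a term `g n` over the variables of `t`. -/
theorem card_imageVars_sysVars_lt_or_isVar {Sg : Type} {ar : Sg → ℕ} {Cα Cβ : GCS Sg ar}
    {E el lnl : List (Tm Sg ar)} {r t : Tm Sg ar} {σ : Subst Sg ar} (hel : ∀ e ∈ el, e ∈ E)
    (hσ : IsMGUSys σ (el.zip lnl ++ [(r, t)])) {W : Set ℕ}
    (hW : ∀ u ∈ r :: lnl, vars u ⊆ W) (g : ℕ → Tm Sg ar)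
    (hg : ∀ n ∈ W, σ n = subst σ (g n) ∧ vars (g n) ⊆ vars t) :
    (imageVars σ (sysVars (Cα ++ (E, t) :: Cβ))).card < (sysVars (Cα ++ (E, t) :: Cβ)).card ∨
      ∀ n ∈ sysVars (Cα ++ (E, t) :: Cβ), isVar (σ n) := by
  set V := sysVars (Cα ++ (E, t) :: Cβ)
  refine hσ.card_imageVars_lt_or_isVar
    (π := fun n => if n ∈ V then .var n else if n ∈ W then g n else .var n)
    (fun n hn => by simp [hn]) (fun n => ?_) (fun e he n hn m hm => ?_)
  · split_ifs with h₁ h₂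
    · rfl
    · exact (hg n h₂).1.symm
    · rfl
  · split_ifs at hm with h₁ h₂
    · obtain rfl : m = n := by simpa [vars] using hm
      exact h₁
    · exact mem_sysVars_of_mem_cons hel List.mem_cons_self ((hg n h₂).2 hm)
    · obtain ⟨u, hu, hn⟩ | ⟨u, hu, hn⟩ := mem_vars_of_mem_zip he hn
      · exact absurd (mem_sysVars_of_mem_cons hel hu hn) h₁
      · exact absurd (hW u hu hn) h₂

/-- A rule whose conclusion applies a symbol other than `SK` to variables, its premises being
among these variables. -/
def IsComposition (ρ : Rule SgE arE) : Prop :=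
  ∃ s, ∃ v : Fin (arE s) → ℕ, s ≠ .sk ∧ ρ.2 = .app s (fun i => .var (v i)) ∧
    ∀ u ∈ ρ.1, ∃ i, u = .var (v i)

theorem isComposition_of_mem_LDEO {ρ : Rule SgE arE} (h : ρ ∈ LDEO) : IsComposition ρ := by
  obtain rfl | rfl | rfl | rfl | rfl | rfl | rfl := h
  · refine ⟨.sig, ![0, 1], by simp, congrArg _ (funext fun i => ?_), ?_⟩
    · revert i; exact Fin.forall_fin_two.2 ⟨rfl, rfl⟩
    · rintro u (rfl | rfl)
      exacts [⟨(0 : Fin 2), rfl⟩, ⟨(1 : Fin 2), rfl⟩]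
  · refine ⟨.ver, ![0, 1, 2], by simp, congrArg _ (funext fun i => ?_), ?_⟩
    · revert i; exact Fin.forall_fin_succ.2 ⟨rfl, Fin.forall_fin_two.2 ⟨rfl, rfl⟩⟩
    · rintro u (rfl | rfl | rfl)
      exacts [⟨(0 : Fin 3), rfl⟩, ⟨(1 : Fin 3), rfl⟩, ⟨(2 : Fin 3), rfl⟩]
  · refine ⟨.skp, ![0, 1], by simp, congrArg _ (funext fun i => ?_), ?_⟩
    · revert i; exact Fin.forall_fin_two.2 ⟨rfl, rfl⟩
    · rintro u (rfl | rfl)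
      exacts [⟨(0 : Fin 2), rfl⟩, ⟨(1 : Fin 2), rfl⟩]
  · refine ⟨.pkp, ![0, 1], by simp, congrArg _ (funext fun i => ?_), ?_⟩
    · revert i; exact Fin.forall_fin_two.2 ⟨rfl, rfl⟩
    · rintro u (rfl | rfl)
      exacts [⟨(0 : Fin 2), rfl⟩, ⟨(1 : Fin 2), rfl⟩]
  · refine ⟨.f, ![0, 1], by simp, congrArg _ (funext fun i => ?_), ?_⟩
    · revert i; exact Fin.forall_fin_two.2 ⟨rfl, rfl⟩
    · rintro u (rfl | rfl)
      exacts [⟨(0 : Fin 2), rfl⟩, ⟨(1 : Fin 2), rfl⟩]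
  · exact ⟨.zero, ![], by simp, congrArg _ (funext fun i => i.elim0), fun u hu => hu.elim⟩
  · exact ⟨.one, ![], by simp, congrArg _ (funext fun i => i.elim0), fun u hu => hu.elim⟩

open Classical in
theorem IsComposition.smaller_csubst {Cα Cβ : GCS SgE arE} {E lx lnl el : List TmE} {t : TmE}
    {ρ : Rule SgE arE} {σ : Subst SgE arE} (hρ : IsComposition ρ) (ht : ¬ isVar t)
    (hlx : ∀ u ∈ lx, u ∈ ρ.1) (hlnl : ∀ u ∈ lnl, u ∈ ρ.1) (hel : ∀ e ∈ el, e ∈ E)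
    (hσ : IsMGUSys σ (el.zip lnl ++ [(ρ.2, t)])) :
    Smaller (csubst σ (Cα ++ lx.map (fun y => (E, y)) ++ Cβ)) (Cα ++ (E, t) :: Cβ) := by
  obtain ⟨s, v, hs, hr, hl⟩ := hρ
  have hrt := hσ.1 (ρ.2, t) (by simp)
  rw [hr] at hrt
  obtain ⟨b, rfl, hb⟩ := exists_app_of_subst_eq ht hrt
  have hbt : ∀ i, vars (b i) ⊆ vars (Tm.app s b) := Set.subset_iUnion (fun i => vars (b i))
  refine smaller_csubst_of_isVar (card_imageVars_sysVars_lt_or_isVar hel hσ (W := Set.range v)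
    ?_ (fun n => if h : ∃ i, v i = n then b h.choose else .var n) ?_) fun y hy => ?_
  · intro u hu n hn
    obtain rfl | hu := List.mem_cons.1 hu
    · rw [hr] at hn
      obtain ⟨i, hi⟩ := by simpa [vars] using hn
      exact ⟨i, hi⟩
    · obtain ⟨i, rfl⟩ := hl u (hlnl u hu)
      exact ⟨i, (by simpa [vars] using hn : n = v i).symm⟩
  · intro n hn
    have hn : ∃ i, v i = n := hn
    rw [dif_pos hn]
    refine ⟨?_, hbt _⟩
    rw [← hb, subst, hn.choose_spec]
  · obtain ⟨i, rfl⟩ := hl y (hlx y hy)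
    exact ⟨b i, hb i, hbt i, weight_arg_lt hs b i⟩

open Classical in
/-- The signature-forging rule of `LDEO'` deletes a constraint `E ▷ t`; if it also instantiates a
variable `z` by `SK y`, then `y` takes the place of `z` and weights do not change. -/
theorem smaller_csubst_of_forge {Cα Cβ : GCS SgE arE} {E lnl el : List TmE} {t : TmE}
    {σ : Subst SgE arE} (ht : ¬ isVar t) (hlnl : ∀ u ∈ lnl, vars u ⊆ {0, 1})
    (hel : ∀ e ∈ el, e ∈ E) (hσ : IsMGUSys σ (el.zip lnl ++ [(eSig xE (eSk yE), t)])) :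
    Smaller (csubst σ (Cα ++ Cβ)) (Cα ++ (E, t) :: Cβ) := by
  suffices h : Smaller (csubst σ (Cα ++ ([] : List TmE).map (fun y => (E, y)) ++ Cβ))
      (Cα ++ (E, t) :: Cβ) by simpa using h
  obtain ⟨b, rfl, hb⟩ := exists_app_of_subst_eq ht (hσ.1 (eSig xE (eSk yE), t) (by simp))
  have hb₀ : σ 0 = subst σ (b (0 : Fin 2)) := hb (0 : Fin 2)
  have hb₁ : subst σ (eSk yE) = subst σ (b (1 : Fin 2)) := hb (1 : Fin 2)
  have hbt : ∀ i, vars (b i) ⊆ vars (Tm.app SgE.sig b) := Set.subset_iUnion (fun i => vars (b i))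
  have hW : ∀ u ∈ eSig xE (eSk yE) :: lnl, vars u ⊆ {0, 1} := by
    intro u hu
    obtain rfl | hu := List.mem_cons.1 hu
    · rintro n hn
      obtain ⟨i, hi⟩ := Set.mem_iUnion.1 hn
      revert i
      refine Fin.forall_fin_two.2 ⟨fun h => Or.inl h, fun h => ?_⟩
      obtain ⟨i, hi⟩ := Set.mem_iUnion.1 h
      obtain rfl : i = (0 : Fin 1) := Subsingleton.elim (α := Fin 1) _ _
      exact Or.inr hi
    · exact hlnl u hu
  by_cases hz : isVar (b (1 : Fin 2))
  · obtain ⟨z, hz⟩ : ∃ z, b (1 : Fin 2) = .var z := by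
      cases h : b (1 : Fin 2) <;> simp_all [isVar]
    rw [hz] at hb₁
    have hz₁ : z ≠ 1 := by
      rintro rfl
      refine notMem_vars_of_unifies hb₁.symm (by simp [eSk]) ?_
      exact Set.mem_iUnion.2 ⟨(0 : Fin 1), rfl⟩
    set V := sysVars (Cα ++ (E, Tm.app SgE.sig b) :: Cβ) with hV
    have htV : ∀ i, ∀ n ∈ vars (b i), n ∈ V := fun i n hn =>
      mem_sysVars_of_mem_cons hel List.mem_cons_self (hbt i hn)
    have hzV : z ∈ V := htV (1 : Fin 2) z (by rw [hz]; rfl)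
    set V' := insert 1 (V.erase z)
    have hcard : V'.card ≤ V.card := by
      have := Finset.card_insert_le 1 (V.erase z)
      rwa [Finset.card_erase_add_one hzV] at this
    have hzV' : z ∉ V' := by simp [V', hz₁]
    let δ : Subst SgE arE := Function.update Tm.var z (eSk yE)
    have hσδ : ∀ n, subst σ (δ n) = σ n := by
      intro n
      by_cases hn : n = z
      · subst hn
        rw [show δ n = eSk yE from Function.update_self _ _ _]
        exact hb₁
      · simp [δ, hn, subst]
    have hδ : ∀ n ∈ V, ∀ m ∈ vars (δ n), m ∈ V' := by
      intro n hn m hm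
      by_cases hnz : n = z
      · rw [hnz, show δ z = eSk yE from Function.update_self _ _ _] at hm
        obtain ⟨i, hi⟩ := Set.mem_iUnion.1 hm
        obtain rfl : i = (0 : Fin 1) := Subsingleton.elim (α := Fin 1) _ _
        exact Finset.mem_insert.2 (Or.inl hi)
      · obtain rfl : m = n := by simpa [δ, hnz, vars] using hm
        simp [V', hnz, hn]
    have hsub : imageVars σ V ⊆ imageVars σ V' := by
      intro m hm
      obtain ⟨n, hn, hm⟩ := mem_imageVars.1 hm
      rw [← hσδ n, mem_vars_subst] at hm
      obtain ⟨n', hn', hm⟩ := hm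
      exact mem_imageVars.2 ⟨n', hδ n hn n' hn', hm⟩
    have hle := Finset.card_le_card hsub
    have key : (imageVars σ V').card < V'.card ∨ ∀ n ∈ V', isVar (σ n) := by
      refine hσ.card_imageVars_lt_or_isVar
        (π := fun n => if n ∈ V' then .var n else if n = z then eSk yE else
          if n = 0 then subst δ (b (0 : Fin 2)) else .var n)
        (fun n hn => by simp [hn]) (fun n => ?_) (fun e he n hn m hm => ?_)
      · split_ifs with h₁ h₂ h₃
        · rfl
        · rw [h₂]
          exact hb₁
        · rw [subst_subst_eq hσδ, h₃, hb₀]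
        · rfl
      · split_ifs at hm with h₁ h₂ h₃
        · obtain rfl : m = n := by simpa [vars] using hm
          exact h₁
        · exact hδ z hzV m (by simpa [δ] using hm)
        · obtain ⟨k, hk, hm⟩ := mem_vars_subst.1 hm
          exact hδ k (htV _ k hk) m hm
        · obtain ⟨u, hu, hn⟩ | ⟨u, hu, hn⟩ := mem_vars_of_mem_zip he hn
          · have := mem_sysVars_of_mem_cons (Cα := Cα) (Cβ := Cβ) hel hu hn
            exact absurd (by simp [V', h₂, V, this]) h₁
          · obtain hn | hn := hW u hu hn
            · exact absurd hn h₃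
            · exact absurd (by simp [V', show n = 1 from hn]) h₁
    refine smaller_csubst hV (by simp) ?_
    obtain hlt | hvar := key
    · exact Or.inl (by omega)
    · refine Or.inr ⟨(hle.trans (card_imageVars_le_of_isVar hvar)).trans hcard, ?_, by simp⟩
      intro n hn
      by_cases hnz : n = z
      · have : σ n = subst σ (eSk yE) := by rw [hnz]; exact hb₁.symm
        rw [this]
        rfl
      · exact weight_eq_one_of_isVar (hvar n (by simp [V', hnz, hn]))
  · obtain ⟨c, hc, hc'⟩ := exists_app_of_subst_eq hz hb₁
    refine smaller_csubst_of_isVar (card_imageVars_sysVars_lt_or_isVar hel hσ hW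
      (fun n => if n = 0 then b (0 : Fin 2) else c (0 : Fin 1)) ?_) (by simp)
    rintro n (rfl | rfl)
    · exact ⟨hb₀, hbt (0 : Fin 2)⟩
    · refine ⟨hc' (0 : Fin 1), fun m hm => hbt (1 : Fin 2) ?_⟩
      rw [hc]
      exact Set.mem_iUnion.2 ⟨(0 : Fin 1), hm⟩

theorem vars_subset_of_mem_forge_premises {u : TmE}
    (hu : u ∈ ({eF (ePk yE) (eSig xE (eSk yE)), eSkp (ePk yE) (eSig xE (eSk yE))} : Set TmE)) :
    ¬ isVar u ∧ vars u ⊆ {0, 1} := by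
  obtain rfl | rfl := hu <;> refine ⟨id, fun n hn => ?_⟩ <;>
    (simp [eF, eSkp, ePk, eSig, eSk, xE, yE, vars, arE, Fin.exists_fin_two] at hn ⊢; omega)

theorem smaller_of_tStep {C C' : GCS SgE arE} (h : TStep LDEO' C C') : Smaller C' C := by
  cases h with
  | @unif Cα Cβ E t u σ _ _ hu _ hσ =>
    have hut : ∀ w, w = u ∨ w = t → ∀ n ∈ vars w, n ∈ sysVars (Cα ++ (E, t) :: Cβ) := by
      intro w hw n hn
      refine mem_sysVars_of_mem_cons (el := [u]) (u := w) (by simpa using hu) ?_ hn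
      simpa [or_comm] using hw
    have := smaller_csubst_of_isVar (ts := []) (E := E) (t := t) (Cα := Cα) (Cβ := Cβ) (σ := σ)
      (card_imageVars_lt_or_isVar (S := [(u, t)])
        (by simpa [UnifiesSys, Unifies] using hσ.1)
        (by
          simp only [List.mem_singleton, forall_eq, Set.mem_union]
          rintro n (hn | hn)
          · exact hut u (Or.inl rfl) n hn
          · exact hut t (Or.inr rfl) n hn)
        (fun τ hτ => (hσ.2 τ (hτ (u, t) (by simp))).imp fun ρ hρ n _ => hρ n))
      (by simp)
    simpa using this
  | @apply Cα Cβ E t r l lx lnl el σ _ ht hr hlx hl _ hel hσ =>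
    have hlx' : ∀ u ∈ lx, u ∈ l := fun u hu => (hl u).2 (Or.inl hu)
    have hlnl : ∀ u ∈ lnl, u ∈ l := fun u hu => (hl u).2 (Or.inr hu)
    obtain hr | hr := hr
    · exact (isComposition_of_mem_LDEO hr).smaller_csubst ht hlx' hlnl hel hσ
    · obtain ⟨rfl, rfl⟩ := Prod.mk.inj hr
      obtain rfl : lx = [] := List.eq_nil_iff_forall_not_mem.2 fun u hu =>
        (vars_subset_of_mem_forge_premises (hlx' u hu)).1 (hlx u hu)
      simpa using smaller_csubst_of_forge ht
        (fun u hu => (vars_subset_of_mem_forge_premises (hlnl u hu)).2) hel hσ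

/-- for every I_DEO-constraint system, the application of the
transformation rules Apply and Unif (with the saturated rules L'_DEO, modulo
the empty theory) terminates: there is no infinite sequence of transformation
steps. -/
theorem transformation_terminates_DEO (C : GCS SgE arE) :
    ¬ ∃ f : ℕ → GCS SgE arE, f 0 = C ∧ ∀ n, TStep LDEO' (f n) (f (n + 1)) := by
  rintro ⟨f, -, hf⟩
  exact (wellFounded_iff_isEmpty_descending_chain.1 wellFounded_smaller).false
    ⟨f, fun n => smaller_of_tStep (hf n)⟩

end Paper
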